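/- arXiv:2212.09391 — 2 statements merged into one kernel-verified Lean document; each statement's English description precedes it below -/
import Mathlib

section
/- If A ⊆ 𝒫([N]) is an upward-closed family of subsets (i.e. I ∈ A and I ⊆ J implies J ∈ A), then the rejective sampling probability satisfies P_S(A) ≤ 2 P_B(A), where P_B is the corresponding Poisson sampling probability with weights p_i ∈ (0,1) satisfying Σ_i p_i = S. -/
open Finset

/-- Poisson sampling probability of the sample `I`. -/
noncomputable def PB {N : ℕ} (p : Fin N → ℝ) (I : Finset (Fin N)) : ℝ :=
  (∏ i ∈ I, p i) * ∏ j ∈ Iᶜ, (1 - p j)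

/-- Inclusion probability `π_L(S)` under rejective sampling with parameter `S`. -/
noncomputable def incl {N : ℕ} (p : Fin N → ℝ) (S : ℕ) (L : Finset (Fin N)) : ℝ :=
  (∑ I ∈ univ.filter (fun I => I.card = S ∧ L ⊆ I), PB p I) /
  (∑ I ∈ univ.filter (fun I => I.card = S), PB p I)


lemma PB_pos' {N : ℕ} (p : Fin N → ℝ) (hp : ∀ i, p i ∈ Set.Ioo (0 : ℝ) 1) (I : Finset (Fin N)) :
    0 < PB p I := by
  unfold PB
  apply mul_pos
  · exact Finset.prod_pos fun i _ => (hp i).1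
  · exact Finset.prod_pos fun i _ => by linarith [(hp i).2]

lemma PB_insert_aux {N : ℕ} (p : Fin N → ℝ) (I : Finset (Fin N)) (j : Fin N) (hj : j ∉ I) :
    PB p I = ((∏ i ∈ I, p i) * ∏ i ∈ (insert j I)ᶜ, (1 - p i)) * (1 - p j) ∧
    PB p (insert j I) = ((∏ i ∈ I, p i) * ∏ i ∈ (insert j I)ᶜ, (1 - p i)) * p j := by
  unfold PB
  constructor
  · have h : Iᶜ = insert j (insert j I)ᶜ := by
      ext x; simp only [mem_compl, mem_insert]
      by_cases h : x = j
      · subst h; simp [hj]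
      · simp [h]
    rw [h, Finset.prod_insert (by simp)]; ring
  · rw [Finset.prod_insert hj]; ring

lemma PB_swap {N : ℕ} (p : Fin N → ℝ) (I J : Finset (Fin N)) (j : Fin N) (hj : j ∉ I)
    (hJ : j ∈ J) : PB p (insert j I) * PB p (J.erase j) = PB p I * PB p J := by
  have h1 := PB_insert_aux p I j hj
  have h2 := PB_insert_aux p (J.erase j) j (Finset.notMem_erase j J)
  rw [Finset.insert_erase hJ] at h2
  rw [h1.1, h1.2, h2.1, h2.2]; ring

lemma level_step {N : ℕ} (p : Fin N → ℝ) (hp : ∀ i, p i ∈ Set.Ioo (0 : ℝ) 1)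
    (A : Finset (Finset (Fin N)))
    (hA : ∀ I ∈ A, ∀ J : Finset (Fin N), I ⊆ J → J ∈ A) (k : ℕ) :
    (∑ I ∈ A.filter (fun I => I.card = k), PB p I) *
      (∑ I ∈ univ.filter (fun I => I.card = k + 1), PB p I) ≤
    (∑ I ∈ A.filter (fun I => I.card = k + 1), PB p I) *
      (∑ I ∈ univ.filter (fun I => I.card = k), PB p I) := by
  rw [Finset.sum_mul_sum, Finset.sum_mul_sum, ← Finset.sum_product', ← Finset.sum_product']
  have e1 : ∀ x ∈ (A.filter (fun I => I.card = k)) ×ˢ (univ.filter (fun I : Finset (Fin N) => I.card = k + 1)),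
      PB p x.1 * PB p x.2 = ∑ j ∈ x.2 \ x.1, PB p x.1 * PB p x.2 / ((x.2 \ x.1).card : ℝ) := by
    rintro ⟨I, J⟩ h
    simp only [mem_product, mem_filter, mem_univ, true_and] at h
    have := Finset.le_card_sdiff I J
    have : ((J \ I).card : ℝ) ≠ 0 := by
      have : 0 < (J \ I).card := by omega
      positivity
    rw [Finset.sum_const, nsmul_eq_mul]; field_simp
  have e2 : ∀ x ∈ (A.filter (fun I => I.card = k + 1)) ×ˢ (univ.filter (fun I : Finset (Fin N) => I.card = k)),
      PB p x.1 * PB p x.2 = ∑ j ∈ x.1 \ x.2, PB p x.1 * PB p x.2 / ((x.1 \ x.2).card : ℝ) := by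
    rintro ⟨I, J⟩ h
    simp only [mem_product, mem_filter, mem_univ, true_and] at h
    have := Finset.le_card_sdiff J I
    have : ((I \ J).card : ℝ) ≠ 0 := by
      have : 0 < (I \ J).card := by omega
      positivity
    rw [Finset.sum_const, nsmul_eq_mul]; field_simp
  rw [Finset.sum_congr rfl e1, Finset.sum_congr rfl e2, Finset.sum_sigma', Finset.sum_sigma']
  let φ : ((_ : Finset (Fin N) × Finset (Fin N)) × Fin N) →
      ((_ : Finset (Fin N) × Finset (Fin N)) × Fin N) :=
    fun y => ⟨(insert y.2 y.1.1, y.1.2.erase y.2), y.2⟩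
  set T1 := ((A.filter (fun I => I.card = k)) ×ˢ
    (univ.filter (fun I : Finset (Fin N) => I.card = k + 1))).sigma (fun x => x.2 \ x.1) with hT1
  have inj : Set.InjOn φ (T1 : Set _) := by
    rintro ⟨⟨I, J⟩, j⟩ h ⟨⟨I', J'⟩, j'⟩ h' he
    simp only [hT1, Finset.mem_coe, mem_sigma, mem_product, mem_filter, mem_univ, true_and, mem_sdiff] at h h'
    simp only [φ, Sigma.mk.injEq, Prod.mk.injEq, heq_eq_eq] at he
    obtain ⟨⟨ha, hb⟩, hc⟩ := he
    subst hc
    have h1 : I = I' := by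
      rw [← Finset.erase_insert h.2.2, ha, Finset.erase_insert h'.2.2]
    have h2 : J = J' := by
      rw [← Finset.insert_erase h.2.1, hb, Finset.insert_erase h'.2.1]
    subst h1; subst h2; rfl
  have step : ∑ x ∈ T1, PB p x.1.1 * PB p x.1.2 / ((x.1.2 \ x.1.1).card : ℝ) =
      ∑ x ∈ T1.image φ, PB p x.1.1 * PB p x.1.2 / ((x.1.1 \ x.1.2).card : ℝ) := by
    rw [Finset.sum_image inj]
    apply Finset.sum_congr rfl
    rintro ⟨⟨I, J⟩, j⟩ h
    simp only [hT1, mem_sigma, mem_product, mem_filter, mem_univ, true_and, mem_sdiff] at h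
    obtain ⟨⟨⟨hIA, hI⟩, hJ⟩, hjJ, hjI⟩ := h
    simp only [φ]
    rw [PB_swap p I J j hjI hjJ]
    congr 2
    have a1 : (insert j I \ J.erase j) = insert j (I \ J) := by
      ext x; simp only [mem_sdiff, mem_insert, mem_erase]
      by_cases h : x = j
      · simp [h]
      · simp [h]
    rw [a1, Finset.card_insert_of_notMem (by simp [hjJ])]
    have b1 := Finset.card_sdiff_add_card_inter I J
    have b2 := Finset.card_sdiff_add_card_inter J I
    rw [Finset.inter_comm] at b2
    omega
  rw [step]
  apply Finset.sum_le_sum_of_subset_of_nonneg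
  · intro y hy
    rw [Finset.mem_image] at hy
    obtain ⟨⟨⟨I, J⟩, j⟩, h, rfl⟩ := hy
    simp only [hT1, mem_sigma, mem_product, mem_filter, mem_univ, true_and, mem_sdiff] at h
    obtain ⟨⟨⟨hIA, hI⟩, hJ⟩, hjJ, hjI⟩ := h
    simp only [φ, mem_sigma, mem_product, mem_filter, mem_univ, true_and, mem_sdiff]
    refine ⟨⟨⟨hA I hIA _ (Finset.subset_insert _ _), ?_⟩, ?_⟩, ?_, ?_⟩
    · rw [Finset.card_insert_of_notMem hjI, hI]
    · rw [Finset.card_erase_of_mem hjJ, hJ]; rfl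
    · simp
    · simp
  · intro y _ _
    have := (PB_pos' p hp y.1.1).le
    have := (PB_pos' p hp y.1.2).le
    positivity

lemma level_mono {N : ℕ} (p : Fin N → ℝ) (hp : ∀ i, p i ∈ Set.Ioo (0 : ℝ) 1)
    (A : Finset (Finset (Fin N)))
    (hA : ∀ I ∈ A, ∀ J : Finset (Fin N), I ⊆ J → J ∈ A) (S k : ℕ) (hSk : S ≤ k) (hk : k ≤ N) :
    (∑ I ∈ A.filter (fun I => I.card = S), PB p I) *
      (∑ I ∈ univ.filter (fun I => I.card = k), PB p I) ≤
    (∑ I ∈ A.filter (fun I => I.card = k), PB p I) *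
      (∑ I ∈ univ.filter (fun I => I.card = S), PB p I) := by
  have W : ∀ k ≤ N, 0 < ∑ I ∈ univ.filter (fun I : Finset (Fin N) => I.card = k), PB p I := by
    intro k hk
    apply Finset.sum_pos (fun I _ => PB_pos' p hp I)
    obtain ⟨t, _, ht⟩ := Finset.exists_subset_card_eq (s := (univ : Finset (Fin N))) (n := k) (by simpa using hk)
    exact ⟨t, by simp [ht]⟩
  induction k, hSk using Nat.le_induction with
  | base => exact le_refl _
  | succ k hSk ih =>
    have ih := ih (by omega)
    have st := level_step p hp A hA k
    have w0 := W k (by omega)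
    have w1 := W (k+1) hk
    have w2 := W S (by omega)
    refine le_of_mul_le_mul_right ?_ w0
    have i1 := mul_le_mul_of_nonneg_right ih w1.le
    have i2 := mul_le_mul_of_nonneg_right st w2.le
    nlinarith

lemma final_of_half {N S : ℕ} (p : Fin N → ℝ)
    (hp : ∀ i, p i ∈ Set.Ioo (0 : ℝ) 1) (hSN : S ≤ N)
    (A : Finset (Finset (Fin N)))
    (hA : ∀ I ∈ A, ∀ J : Finset (Fin N), I ⊆ J → J ∈ A)
    (half : 1 / 2 ≤ ∑ I ∈ univ.filter (fun I : Finset (Fin N) => S ≤ I.card), PB p I) :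
    (∑ I ∈ A.filter (fun I => I.card = S), PB p I) /
      (∑ I ∈ univ.filter (fun I => I.card = S), PB p I) ≤
    2 * ∑ I ∈ A, PB p I := by
  have W : 0 < ∑ I ∈ univ.filter (fun I : Finset (Fin N) => I.card = S), PB p I := by
    apply Finset.sum_pos (fun I _ => PB_pos' p hp I)
    obtain ⟨t, _, ht⟩ := Finset.exists_subset_card_eq (s := (univ : Finset (Fin N))) (n := S) (by simpa using hSN)
    exact ⟨t, by simp [ht]⟩
  rw [div_le_iff₀ W]
  have key : ∀ B : Finset (Finset (Fin N)), ∑ I ∈ B.filter (fun I => S ≤ I.card), PB p I =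
      ∑ k ∈ Icc S N, ∑ I ∈ B.filter (fun I => I.card = k), PB p I := by
    intro B
    rw [← Finset.sum_fiberwise_of_maps_to (s := B.filter (fun I => S ≤ I.card)) (t := Icc S N) (g := Finset.card)]
    · apply Finset.sum_congr rfl
      intro k hk
      rw [Finset.filter_filter]
      apply Finset.sum_congr _ (fun _ _ => rfl)
      ext I; simp only [mem_filter, mem_Icc] at *
      constructor
      · rintro ⟨a, b, c⟩; exact ⟨a, c⟩
      · rintro ⟨a, c⟩; exact ⟨a, by omega, c⟩
    · intro I hI
      simp only [mem_filter, mem_Icc] at *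
      exact ⟨hI.2, by simpa using Finset.card_le_univ I⟩
  have h1 : (∑ I ∈ A.filter (fun I => I.card = S), PB p I) *
      (∑ I ∈ univ.filter (fun I : Finset (Fin N) => S ≤ I.card), PB p I) ≤
      (∑ I ∈ A.filter (fun I => S ≤ I.card), PB p I) *
      (∑ I ∈ univ.filter (fun I => I.card = S), PB p I) := by
    rw [key, key, Finset.mul_sum, Finset.sum_mul]
    apply Finset.sum_le_sum
    intro k hk
    rw [mem_Icc] at hk
    exact level_mono p hp A hA S k hk.1 hk.2
  have h2 : (∑ I ∈ A.filter (fun I => S ≤ I.card), PB p I) ≤ ∑ I ∈ A, PB p I :=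
    Finset.sum_le_sum_of_subset_of_nonneg (Finset.filter_subset _ _) (fun I _ _ => (PB_pos' p hp I).le)
  have h3 : 0 ≤ ∑ I ∈ A.filter (fun I => I.card = S), PB p I :=
    Finset.sum_nonneg (fun I _ => (PB_pos' p hp I).le)
  have h4 := mul_le_mul_of_nonneg_right h2 W.le
  have h5 := mul_le_mul_of_nonneg_left half h3
  linarith

noncomputable def bb (n : ℕ) (a : ℝ) (k : ℕ) : ℝ := (n.choose k : ℝ) * a ^ k * (1 - a) ^ (n - k)

lemma bb_rec (n s k : ℕ) (a : ℝ) (hs : (n : ℝ) * a = s) :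
    bb n a (k + 1) * (k + 1) * (n - s) = bb n a k * (n - k) * s := by
  unfold bb
  have hc := Nat.choose_succ_right_eq n k
  rcases lt_or_ge k n with h | h
  · have hc' : (n.choose (k+1) : ℝ) * (k + 1) = n.choose k * (n - k) := by
      have := congrArg (Nat.cast : ℕ → ℝ) hc
      push_cast [Nat.cast_sub h.le] at this
      exact this
    obtain ⟨r, rfl⟩ : ∃ r, n = k + 1 + r := ⟨n - (k+1), by omega⟩
    have e1 : k + 1 + r - (k + 1) = r := by omega
    have e2 : k + 1 + r - k = r + 1 := by omega
    rw [e1, e2, ← hs]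
    calc _ = ((k + 1 + r).choose (k+1) : ℝ) * (k + 1) * (a ^ (k+1) * (1 - a)^(r+1) * ((k+1+r : ℕ) : ℝ)) := by ring
      _ = _ := by rw [hc']; ring
  · rw [Nat.choose_eq_zero_of_lt (by omega : n < k + 1)]
    rcases h.eq_or_lt with h | h
    · subst h; simp
    · rw [Nat.choose_eq_zero_of_lt h]; simp

lemma bb_nonneg (n k : ℕ) (a : ℝ) (h0 : 0 < a) (h1 : a < 1) : 0 ≤ bb n a k := by
  unfold bb
  have : 0 < 1 - a := by linarith
  positivity

lemma bb_pos (n k : ℕ) (a : ℝ) (h0 : 0 < a) (h1 : a < 1) (hk : k ≤ n) : 0 < bb n a k := by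
  unfold bb
  have : 0 < 1 - a := by linarith
  have : 0 < n.choose k := Nat.choose_pos hk
  positivity

lemma bb_sum (n : ℕ) (a : ℝ) : ∑ k ∈ range (n + 1), bb n a k = 1 := by
  have := congrArg (Polynomial.eval a) (bernsteinPolynomial.sum ℝ n)
  simp only [Polynomial.eval_finsetSum, bernsteinPolynomial, Polynomial.eval_mul, Polynomial.eval_pow,
    Polynomial.eval_natCast, Polynomial.eval_X, Polynomial.eval_sub, Polynomial.eval_one] at this
  exact this

lemma bb_mean (n : ℕ) (a : ℝ) : ∑ k ∈ range (n + 1), (k : ℝ) * bb n a k = n * a := by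
  have := congrArg (Polynomial.eval a) (bernsteinPolynomial.sum_smul ℝ n)
  simp only [Polynomial.eval_finsetSum, bernsteinPolynomial, Polynomial.eval_mul, Polynomial.eval_pow,
    Polynomial.eval_natCast, Polynomial.eval_X, Polynomial.eval_sub, Polynomial.eval_one, nsmul_eq_mul] at this
  exact this

/-- product identity -/
lemma bb_two (n s i : ℕ) (a : ℝ) (hs : (n : ℝ) * a = s) (hi : i + 2 ≤ s) :
    bb n a (s + (i + 1)) * bb n a (s - 1 - i) * (((s:ℝ) + i + 1) * (s - 1 - i) * (n - s) ^ 2) =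
    bb n a (s + i) * bb n a (s - 1 - (i + 1)) * (((n:ℝ) - s - i) * (n - s + i + 2) * s ^ 2) := by
  have r1 := bb_rec n s (s + i) a hs
  have r2 := bb_rec n s (s - 1 - (i + 1)) a hs
  have e : s - 1 - (i + 1) + 1 = s - 1 - i := by omega
  have e' : ((s - 1 - (i + 1) : ℕ) : ℝ) = s - 2 - i := by
    have : s - 1 - (i + 1) = s - (i + 2) := by omega
    rw [this, Nat.cast_sub hi]; push_cast; ring
  rw [e, e'] at r2
  rw [show s + i + 1 = s + (i + 1) by ring] at r1
  push_cast at r1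
  have := congrArg₂ (· * ·) r1 r2
  linear_combination this

lemma bb_up (n s i : ℕ) (a : ℝ) (h0 : 0 < a) (h1 : a < 1) (hsn : s < n)
    (hs : (n : ℝ) * a = s) (hi : i + 2 ≤ s)
    (hh : ((s:ℝ) + i + 1) * (s - 1 - i) * (n - s) ^ 2 ≤ ((n:ℝ) - s - i) * (n - s + i + 2) * s ^ 2)
    (he : bb n a (s - 1 - i) ≤ bb n a (s + i)) :
    bb n a (s - 1 - (i + 1)) ≤ bb n a (s + (i + 1)) := by
  have h2 := bb_two n s i a hs hi
  have hp1 := bb_pos n (s - 1 - i) a h0 h1 (by omega)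
  have hp2 := bb_pos n (s - 1 - (i+1)) a h0 h1 (by omega)
  have hp3 := bb_nonneg n (s + i) a h0 h1
  have hi' : ((i:ℝ) + 2) ≤ s := by exact_mod_cast hi
  have hn' : (s:ℝ) < n := by exact_mod_cast hsn
  have c0 : 0 < ((s:ℝ) + i + 1) * (s - 1 - i) * (n - s) ^ 2 := by
    have : (0:ℝ) < s - 1 - i := by linarith
    have : (0:ℝ) < n - s := by linarith
    positivity
  have k1 : bb n a (s + i) * bb n a (s - 1 - (i + 1)) * (((s:ℝ) + i + 1) * (s - 1 - i) * (n - s) ^ 2) ≤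
      bb n a (s + (i + 1)) * bb n a (s - 1 - i) * (((s:ℝ) + i + 1) * (s - 1 - i) * (n - s) ^ 2) := by
    rw [h2]
    exact mul_le_mul_of_nonneg_left hh (by positivity)
  have k2 := le_of_mul_le_mul_right k1 c0
  have k3 := mul_le_mul_of_nonneg_right he hp2.le
  refine le_of_mul_le_mul_right ?_ hp1
  linarith

lemma bb_down (n s i : ℕ) (a : ℝ) (h0 : 0 < a) (h1 : a < 1) (hsn : s < n)
    (hs : (n : ℝ) * a = s) (hi : i + 2 ≤ s)
    (hh : ((n:ℝ) - s - i) * (n - s + i + 2) * s ^ 2 ≤ ((s:ℝ) + i + 1) * (s - 1 - i) * (n - s) ^ 2)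
    (he : bb n a (s + i) < bb n a (s - 1 - i)) :
    bb n a (s + (i + 1)) < bb n a (s - 1 - (i + 1)) := by
  have h2 := bb_two n s i a hs hi
  have hp1 := bb_pos n (s - 1 - i) a h0 h1 (by omega)
  have hp2 := bb_pos n (s - 1 - (i+1)) a h0 h1 (by omega)
  have hp3 := bb_nonneg n (s + i) a h0 h1
  have hi' : ((i:ℝ) + 2) ≤ s := by exact_mod_cast hi
  have hn' : (s:ℝ) < n := by exact_mod_cast hsn
  have c0 : 0 < ((s:ℝ) + i + 1) * (s - 1 - i) * (n - s) ^ 2 := by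
    have : (0:ℝ) < s - 1 - i := by linarith
    have : (0:ℝ) < n - s := by linarith
    positivity
  have k1 : bb n a (s + (i + 1)) * bb n a (s - 1 - i) * (((s:ℝ) + i + 1) * (s - 1 - i) * (n - s) ^ 2) ≤
     bb n a (s + i) * bb n a (s - 1 - (i + 1)) * (((s:ℝ) + i + 1) * (s - 1 - i) * (n - s) ^ 2) := by
    rw [h2]
    exact mul_le_mul_of_nonneg_left hh (by positivity)
  have k2 := le_of_mul_le_mul_right k1 c0
  have k3 := mul_lt_mul_of_pos_right he hp2
  refine lt_of_mul_lt_mul_right ?_ hp1.le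
  linarith

lemma bb_zero (n s : ℕ) (a : ℝ) (h0 : 0 < a) (h1 : a < 1) (hsn : s < n) (hs0 : 1 ≤ s)
    (hs : (n : ℝ) * a = s) : bb n a (s - 1 - 0) ≤ bb n a (s + 0) := by
  have r := bb_rec n s (s - 1) a hs
  rw [Nat.sub_add_cancel hs0, Nat.cast_sub hs0] at r
  have hp := bb_pos n (s - 1) a h0 h1 (by omega)
  have hs' : (1:ℝ) ≤ s := by exact_mod_cast hs0
  have hn' : (s:ℝ) < n := by exact_mod_cast hsn
  simp only [Nat.sub_zero, add_zero]
  push_cast at r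
  have c0 : 0 < (s:ℝ) * (n - s) := mul_pos (by linarith) (by linarith)
  refine le_of_mul_le_mul_right ?_ c0
  nlinarith [mul_pos hp (by linarith : (0:ℝ) < s)]

lemma h_ident (n s i : ℝ) : (n - s - i) * (n - s + i + 2) * s ^ 2 - (s + i + 1) * (s - 1 - i) * (n - s) ^ 2
    = s^2 * (2 * (n - s) + 1) - (i+1)^2 * (s^2 - (n-s)^2) := by ring

lemma binom_half (n s : ℕ) (a : ℝ) (h0 : 0 < a) (h1 : a < 1) (hs : (n : ℝ) * a = s) :
    1 / 2 ≤ ∑ k ∈ (range (n + 1)).filter (fun k => s ≤ k), bb n a k := by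
  rcases Nat.eq_zero_or_pos s with rfl | hs0
  · simp only [Nat.zero_le, Finset.filter_true, bb_sum]; norm_num
  have hn0 : 0 < n := by
    rcases Nat.eq_zero_or_pos n with rfl | h
    · exfalso; rw [Nat.cast_zero, zero_mul] at hs; have : (0:ℝ) < s := by exact_mod_cast hs0
      linarith
    · exact h
  have hnR : (0:ℝ) < n := by exact_mod_cast hn0
  have hsn : s < n := by
    have : (s:ℝ) < n := by rw [← hs]; nlinarith
    exact_mod_cast this
  have hsnR : (s:ℝ) < n := by exact_mod_cast hsn
  have hsR : (0:ℝ) < s := by exact_mod_cast hs0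
  -- suffices comparison
  have hlow : (range (n+1)).filter (fun k => ¬ s ≤ k) = range s := by
    ext k; simp only [mem_filter, mem_range]; omega
  have tot := Finset.sum_filter_add_sum_filter_not (range (n+1)) (fun k => s ≤ k) (fun k => bb n a k)
  rw [bb_sum, hlow] at tot
  have hrefl : ∑ i ∈ range s, bb n a (s - 1 - i) = ∑ k ∈ range s, bb n a k := Finset.sum_range_reflect _ _
  have hupper : ∑ i ∈ range s, bb n a (s + i) ≤ ∑ k ∈ (range (n + 1)).filter (fun k => s ≤ k), bb n a k := by
    have e : ∑ i ∈ range s, bb n a (s + i) = ∑ k ∈ (range s).image (fun i => s + i), bb n a k := by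
      rw [Finset.sum_image]; intro x _ y _ h; simpa using h
    rw [e, ← Finset.sum_filter_add_sum_filter_not _ (fun k => k ≤ n)]
    have z : ∑ k ∈ ((range s).image (fun i => s + i)).filter (fun k => ¬ k ≤ n), bb n a k = 0 := by
      apply Finset.sum_eq_zero
      intro k hk
      rw [mem_filter] at hk
      unfold bb
      rw [Nat.choose_eq_zero_of_lt (by omega)]; simp
    rw [z, add_zero]
    apply Finset.sum_le_sum_of_subset_of_nonneg
    · intro k hk
      simp only [mem_filter, mem_image, mem_range] at *
      obtain ⟨⟨i, hi, rfl⟩, h⟩ := hk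
      omega
    · intro k _ _; exact bb_nonneg n k a h0 h1
  suffices H : ∑ i ∈ range s, bb n a (s - 1 - i) ≤ ∑ i ∈ range s, bb n a (s + i) by linarith
  -- pattern
  have pat : ∀ i, i + 2 ≤ s → bb n a (s + i) < bb n a (s - 1 - i) →
      bb n a (s + (i + 1)) < bb n a (s - 1 - (i + 1)) := by
    intro i hi hlt
    apply bb_down n s i a h0 h1 hsn hs hi _ hlt
    by_contra hcon
    push Not at hcon
    have hpre : ∀ j ≤ i, bb n a (s - 1 - j) ≤ bb n a (s + j) := by
      intro j
      induction j with
      | zero => intro _; exact bb_zero n s a h0 h1 hsn hs0 hs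
      | succ j ih =>
        intro hj
        apply bb_up n s j a h0 h1 hsn hs (by omega) _ (ih (by omega))
        have d1 := h_ident n s i
        have d2 := h_ident n s j
        have hji : (j:ℝ) ≤ i := by exact_mod_cast (by omega : j ≤ i)
        have hj0 : (0:ℝ) ≤ j := by positivity
        have hsq : ((j:ℝ)+1)^2 ≤ (i+1)^2 := by gcongr
        rcases le_total ((s:ℝ)^2 - (n-s)^2) 0 with hneg | hpos
        · have : 0 ≤ (s:ℝ)^2 * (2 * (n - s) + 1) := mul_nonneg (by positivity) (by linarith)
          nlinarith [mul_nonneg (sq_nonneg ((j:ℝ)+1)) (neg_nonneg.2 hneg)]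
        · nlinarith [mul_le_mul_of_nonneg_right hsq hpos]
    exact absurd (hpre i le_rfl) (not_le.2 hlt)
  by_cases hall : ∀ i < s, bb n a (s - 1 - i) ≤ bb n a (s + i)
  · exact Finset.sum_le_sum fun i hi => hall i (mem_range.1 hi)
  · push Not at hall
    -- s large
    have hbig : n < 2 * s := by
      by_contra hc
      push Not at hc
      obtain ⟨i, hi, hlt⟩ := hall
      have hcR : (2:ℝ) * s ≤ n := by exact_mod_cast hc
      have hpre : ∀ j < s, bb n a (s - 1 - j) ≤ bb n a (s + j) := by
        intro j
        induction j with
        | zero => intro _; exact bb_zero n s a h0 h1 hsn hs0 hs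
        | succ j ih =>
          intro hj
          apply bb_up n s j a h0 h1 hsn hs (by omega) _ (ih (by omega))
          have d2 := h_ident n s j
          have hneg : (s:ℝ)^2 - (n-s)^2 ≤ 0 := by nlinarith
          have : 0 ≤ (s:ℝ)^2 * (2 * (n - s) + 1) := mul_nonneg (by positivity) (by linarith)
          nlinarith [mul_nonneg (sq_nonneg ((j:ℝ)+1)) (neg_nonneg.2 hneg)]
      exact absurd (hpre i hi) (not_le.2 hlt)
    classical
    let j1 := Nat.find hall
    obtain ⟨hj1, hj1lt⟩ := Nat.find_spec hall
    have hbefore : ∀ i < j1, bb n a (s - 1 - i) ≤ bb n a (s + i) := by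
      intro i hi
      have := Nat.find_min hall hi
      push Not at this
      exact this (lt_trans hi hj1)
    have hafter : ∀ i, j1 ≤ i → i < s → bb n a (s + i) < bb n a (s - 1 - i) := by
      intro i hi
      induction i, hi using Nat.le_induction with
      | base => intro _; exact hj1lt
      | succ i hi ih => intro h; exact pat i (by omega) (ih (by omega))
    have hw : 0 ≤ ∑ i ∈ range s, ((j1:ℝ) - i) * (bb n a (s + i) - bb n a (s - 1 - i)) := by
      apply Finset.sum_nonneg
      intro i hi
      rw [mem_range] at hi
      rcases lt_or_ge i j1 with h | h
      · have : (i:ℝ) ≤ j1 := by exact_mod_cast h.le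
        exact mul_nonneg (by linarith) (by linarith [hbefore i h])
      · have : (j1:ℝ) ≤ i := by exact_mod_cast h
        exact mul_nonneg_of_nonpos_of_nonpos (by linarith) (by linarith [hafter i h hi])
    have hmom : ∑ i ∈ range s, ((i:ℝ) + 1/2) * (bb n a (s + i) - bb n a (s - 1 - i)) = 1/2 := by
      have t1 : ∑ k ∈ range (2 * s), ((k:ℝ) - s + 1/2) * bb n a k = 1/2 := by
        have : ∑ k ∈ range (2 * s), ((k:ℝ) - s + 1/2) * bb n a k = ∑ k ∈ range (n+1), ((k:ℝ) - s + 1/2) * bb n a k := by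
          symm
          apply Finset.sum_subset
          · intro k; simp only [mem_range]; omega
          · intro k _ hk
            simp only [mem_range] at hk
            unfold bb
            rw [Nat.choose_eq_zero_of_lt (by omega)]; simp
        rw [this]
        have e : ∀ k ∈ range (n+1), ((k:ℝ) - s + 1/2) * bb n a k = k * bb n a k + (1/2 - s) * bb n a k := by
          intro k _; ring
        rw [Finset.sum_congr rfl e, Finset.sum_add_distrib, ← Finset.mul_sum, bb_sum, bb_mean, hs]; ring
      rw [two_mul, Finset.sum_range_add] at t1
      rw [← Finset.sum_range_reflect] at t1
      refine Eq.trans ?_ t1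
      rw [← Finset.sum_add_distrib]
      apply Finset.sum_congr rfl
      intro i hi
      rw [mem_range] at hi
      have : ((s - 1 - i : ℕ) : ℝ) = s - 1 - i := by
        rw [Nat.sub_sub, Nat.cast_sub (by omega)]; push_cast; ring
      rw [this]; push_cast; ring
    have hsumm : ∑ i ∈ range s, ((j1:ℝ) - i) * (bb n a (s + i) - bb n a (s - 1 - i)) =
        (j1 + 1/2) * (∑ i ∈ range s, bb n a (s + i) - ∑ i ∈ range s, bb n a (s - 1 - i)) - 1/2 := by
      refine Eq.trans ?_ (congrArg (fun t => (j1 + 1/2) * (∑ i ∈ range s, bb n a (s + i) - ∑ i ∈ range s, bb n a (s - 1 - i)) - t) hmom)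
      beta_reduce
      rw [← Finset.sum_sub_distrib, Finset.mul_sum, ← Finset.sum_sub_distrib]
      apply Finset.sum_congr rfl
      intro i _; ring
    rw [hsumm] at hw
    by_contra hc
    push Not at hc
    have : (0:ℝ) ≤ j1 := by positivity
    nlinarith

noncomputable def GP {N : ℕ} (p : Fin N → ℝ) : Polynomial ℝ :=
  ∏ i, (Polynomial.C (1 - p i) + Polynomial.C (p i) * Polynomial.X)

noncomputable def LL (S N : ℕ) : Polynomial ℝ →ₗ[ℝ] ℝ := ∑ k ∈ Icc S N, Polynomial.lcoeff ℝ k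

noncomputable def FF {N : ℕ} (S : ℕ) (p : Fin N → ℝ) : ℝ :=
  ∑ I ∈ univ.filter (fun I : Finset (Fin N) => S ≤ I.card), PB p I

lemma LL_mono (S N r : ℕ) (c : ℝ) (hr : r ≤ N) :
    LL S N (Polynomial.C c * Polynomial.X ^ r) = if S ≤ r then c else 0 := by
  unfold LL
  simp only [LinearMap.sum_apply, Polynomial.lcoeff_apply, Polynomial.coeff_C_mul_X_pow]
  rw [Finset.sum_ite_eq']
  simp [hr]

lemma FF_eq {N : ℕ} (S : ℕ) (p : Fin N → ℝ) : FF S p = LL S N (GP p) := by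
  have : GP p = ∑ I : Finset (Fin N), Polynomial.C (PB p I) * Polynomial.X ^ I.card := by
    unfold GP
    have : ∀ i ∈ (univ : Finset (Fin N)), (Polynomial.C (1 - p i) + Polynomial.C (p i) * Polynomial.X : Polynomial ℝ)
      = Polynomial.C (p i) * Polynomial.X + Polynomial.C (1 - p i) := fun i _ => add_comm _ _
    rw [Finset.prod_congr rfl this, Finset.prod_add, Finset.powerset_univ]
    apply Finset.sum_congr rfl
    intro I _
    unfold PB
    rw [Finset.prod_mul_distrib, Finset.prod_const, Polynomial.C_mul, map_prod, map_prod, Finset.compl_eq_univ_sdiff]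
    ring
  rw [this, map_sum, FF, Finset.sum_filter]
  apply Finset.sum_congr rfl
  intro I _
  rw [LL_mono]
  simpa using Finset.card_le_univ I

lemma FF_cont {N : ℕ} (S : ℕ) : Continuous (fun p : Fin N → ℝ => FF S p) := by
  unfold FF PB
  fun_prop

lemma GP_pair {N : ℕ} (p : Fin N → ℝ) (i j : Fin N) (hij : i ≠ j) :
    ∃ Q : Polynomial ℝ, ∀ x y : ℝ, GP (Function.update (Function.update p i x) j y) =
      Q + (x + y) • ((Polynomial.X - 1) * Q) + (x * y) • ((Polynomial.X - 1) ^ 2 * Q) := by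
  refine ⟨∏ k ∈ (univ.erase i).erase j, (Polynomial.C (1 - p k) + Polynomial.C (p k) * Polynomial.X), ?_⟩
  intro x y
  unfold GP
  rw [← Finset.mul_prod_erase univ _ (mem_univ i),
    ← Finset.mul_prod_erase (univ.erase i) _ (show j ∈ univ.erase i by simp [hij.symm])]
  have : ∀ k ∈ (univ.erase i).erase j,
    (Polynomial.C (1 - Function.update (Function.update p i x) j y k) +
      Polynomial.C (Function.update (Function.update p i x) j y k) * Polynomial.X : Polynomial ℝ) =
    (Polynomial.C (1 - p k) + Polynomial.C (p k) * Polynomial.X) := by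
    intro k hk
    simp only [mem_erase, mem_univ, and_true] at hk
    rw [Function.update_of_ne hk.1, Function.update_of_ne hk.2]
  rw [Finset.prod_congr rfl this]
  rw [Function.update_self, Function.update_of_ne hij, Function.update_self]
  simp only [Polynomial.smul_eq_C_mul, Polynomial.C_sub, Polynomial.C_add, Polynomial.C_mul, Polynomial.C_1]
  ring

lemma FF_pair {N : ℕ} (S : ℕ) (p : Fin N → ℝ) (i j : Fin N) (hij : i ≠ j) :
    ∃ c : ℝ, ∀ x y : ℝ, x + y = p i + p j →
      FF S (Function.update (Function.update p i x) j y) = FF S p + c * (x * y - p i * p j) := by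
  obtain ⟨Q, hQ⟩ := GP_pair p i j hij
  refine ⟨LL S N ((Polynomial.X - 1) ^ 2 * Q), fun x y hxy => ?_⟩
  have h0 := hQ (p i) (p j)
  rw [Function.update_eq_self, Function.update_eq_self] at h0
  rw [FF_eq, FF_eq, hQ, h0]
  simp only [map_add, map_smul, smul_eq_mul, hxy]
  ring

lemma sum_pair {N : ℕ} (f : ℝ → ℝ) (p : Fin N → ℝ) (i j : Fin N) (hij : i ≠ j) (x y : ℝ) :
    ∑ k, f (Function.update (Function.update p i x) j y k) = ∑ k, f (p k) + (f x + f y - f (p i) - f (p j)) := by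
  rw [← Finset.add_sum_erase univ _ (mem_univ i),
    ← Finset.add_sum_erase (univ.erase i) _ (show j ∈ univ.erase i by simp [hij.symm]),
    ← Finset.add_sum_erase univ (fun k => f (p k)) (mem_univ i),
    ← Finset.add_sum_erase (univ.erase i) (fun k => f (p k)) (show j ∈ univ.erase i by simp [hij.symm])]
  have : ∀ k ∈ (univ.erase i).erase j,
    f (Function.update (Function.update p i x) j y k) = f (p k) := by
    intro k hk
    simp only [mem_erase, mem_univ, and_true] at hk
    rw [Function.update_of_ne hk.1, Function.update_of_ne hk.2]
  rw [Finset.sum_congr rfl this]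
  rw [Function.update_self, Function.update_of_ne hij, Function.update_self]
  ring

lemma three_half {N S : ℕ} (p : Fin N → ℝ) (hsum : ∑ i, p i = S) (a : ℝ) (h0 : 0 < a) (h1 : a < 1)
    (h : ∀ i, p i = 0 ∨ p i = 1 ∨ p i = a) : 1 / 2 ≤ FF S p := by
  classical
  set m := (univ.filter (fun i => p i = 1)).card with hm
  set n := (univ.filter (fun i => p i = a)).card with hn
  have hG : GP p = Polynomial.X ^ m * (Polynomial.C a * Polynomial.X + Polynomial.C (1 - a)) ^ n := by
    have : ∀ i ∈ (univ : Finset (Fin N)), (Polynomial.C (1 - p i) + Polynomial.C (p i) * Polynomial.X : Polynomial ℝ) =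
      (if p i = 1 then Polynomial.X else 1) *
      (if p i = a then (Polynomial.C a * Polynomial.X + Polynomial.C (1 - a)) else 1) := by
      intro i _
      rcases h i with h | h | h
      · simp [h, h0.ne]
      · simp [h, h1.ne']
      · simp [h, h1.ne]; ring
    unfold GP
    rw [Finset.prod_congr rfl this, Finset.prod_mul_distrib, ← Finset.prod_filter, ← Finset.prod_filter,
      Finset.prod_const, Finset.prod_const]
  have hS : (S:ℝ) = m + n * a := by
    have : ∀ i ∈ (univ : Finset (Fin N)), p i = (if p i = 1 then 1 else 0) + (if p i = a then a else 0) := by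
      intro i _
      rcases h i with h | h | h
      · simp [h, h0.ne]
      · simp [h, h1.ne']
      · simp [h, h1.ne]
    rw [← hsum, Finset.sum_congr rfl this, Finset.sum_add_distrib, ← Finset.sum_filter, ← Finset.sum_filter,
      Finset.sum_const, Finset.sum_const]
    simp [hm, hn]
  have hmn : m + n ≤ N := by
    have hd : Disjoint (univ.filter (fun i => p i = 1)) (univ.filter (fun i => p i = a)) := by
      rw [Finset.disjoint_filter]
      intro i _ e1 e2; linarith
    rw [hm, hn, ← Finset.card_union_of_disjoint hd]
    simpa using Finset.card_le_univ (univ.filter (fun i => p i = 1) ∪ univ.filter (fun i => p i = a))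
  obtain ⟨s, hs⟩ : ∃ s, S = m + s := by
    apply Nat.exists_eq_add_of_le
    have : (m:ℝ) ≤ S := by rw [hS]; have : 0 ≤ n * a := by positivity
                           linarith
    exact_mod_cast this
  have hna : (n:ℝ) * a = s := by rw [hs] at hS; push_cast at hS; linarith
  have := binom_half n s a h0 h1 hna
  rw [FF_eq, hG, add_pow, Finset.mul_sum, map_sum]
  rw [Finset.sum_filter] at this
  refine this.trans (le_of_eq ?_)
  apply Finset.sum_congr rfl
  intro k hk
  rw [mem_range] at hk
  have e : (Polynomial.X ^ m * ((Polynomial.C a * Polynomial.X) ^ k * Polynomial.C (1 - a) ^ (n - k) * (n.choose k : Polynomial ℝ)) : Polynomial ℝ)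
     = Polynomial.C (bb n a k) * Polynomial.X ^ (m + k) := by
    unfold bb
    simp only [Polynomial.C_mul, Polynomial.C_pow, map_natCast]
    ring
  rw [e, LL_mono _ _ _ _ (by omega), hs]
  simp

lemma half_main {N S : ℕ} (p : Fin N → ℝ)
    (hp : ∀ i, p i ∈ Set.Ioo (0 : ℝ) 1) (hsum : ∑ i, p i = S) : 1 / 2 ≤ FF S p := by
  classical
  let K : Set (Fin N → ℝ) := (Set.univ.pi fun _ => Set.Icc (0:ℝ) 1) ∩ {q | ∑ i, q i = S}
  have hK : IsCompact K := by
    apply IsCompact.inter_right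
    · exact isCompact_univ_pi fun _ => isCompact_Icc
    · exact isClosed_eq (by fun_prop) continuous_const
  have hpK : p ∈ K := ⟨fun i _ => ⟨(hp i).1.le, (hp i).2.le⟩, hsum⟩
  obtain ⟨q0, hq0, hmin0⟩ := hK.exists_isMinOn ⟨p, hpK⟩ (FF_cont S).continuousOn
  have hK2 : IsCompact (K ∩ {q | FF S q = FF S q0}) :=
    hK.inter_right (isClosed_eq (FF_cont S) continuous_const)
  obtain ⟨q, ⟨hqK, hqF⟩, hmin1⟩ := hK2.exists_isMinOn (f := fun q : Fin N → ℝ => ∑ i, (q i)^2) ⟨q0, hq0, rfl⟩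
    (by fun_prop)
  have hqF : FF S q = FF S q0 := hqF
  have hmin : ∀ r ∈ K, FF S q ≤ FF S r := fun r hr => by rw [hqF]; exact hmin0 hr
  have hbd : ∀ i, 0 ≤ q i ∧ q i ≤ 1 := fun i => hqK.1 i (Set.mem_univ i)
  have hqs : ∑ i, q i = S := hqK.2
  suffices H : 1 / 2 ≤ FF S q from H.trans (hmin p hpK)
  have key : ∀ i j, 0 < q i → q j < 1 → ¬ q i < q j := by
    intro i j hi hj hlt
    have hij : i ≠ j := by rintro rfl; exact lt_irrefl _ hlt
    obtain ⟨c, hc⟩ := FF_pair S q i j hij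
    have mem : ∀ x y, 0 ≤ x → x ≤ 1 → 0 ≤ y → y ≤ 1 → x + y = q i + q j →
        Function.update (Function.update q i x) j y ∈ K := by
      intro x y hx0 hx1 hy0 hy1 hxy
      constructor
      · intro k _
        by_cases hkj : k = j
        · subst hkj; rw [Function.update_self]; exact ⟨hy0, hy1⟩
        · rw [Function.update_of_ne hkj]
          by_cases hki : k = i
          · subst hki; rw [Function.update_self]; exact ⟨hx0, hx1⟩
          · rw [Function.update_of_ne hki]; exact hbd k
      · have := sum_pair (fun t => t) q i j hij x y
        show ∑ k, _ = _
        rw [this, hqs]; linarith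
    have b1 := hbd i
    have b2 := hbd j
    set ε := min (q i) (1 - q j) with hε
    have e0 : 0 < ε := lt_min hi (by linarith)
    have e1 : ε ≤ q i := min_le_left _ _
    have e2 : ε ≤ 1 - q j := min_le_right _ _
    have m1 := hmin _ (mem (q i - ε) (q j + ε) (by linarith) (by linarith) (by linarith) (by linarith) (by ring))
    rw [hc _ _ (by ring)] at m1
    have hv := mem ((q i + q j)/2) ((q i + q j)/2) (by linarith) (by linarith) (by linarith) (by linarith) (by ring)
    have m2 := hmin _ hv
    have hcv := hc ((q i + q j)/2) ((q i + q j)/2) (by ring)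
    rw [hcv] at m2
    have c1 : c ≤ 0 := by
      by_contra hcon
      push Not at hcon
      have : (q i - ε) * (q j + ε) - q i * q j < 0 := by nlinarith
      nlinarith
    have c2 : 0 ≤ c := by
      by_contra hcon
      push Not at hcon
      have : 0 < (q i + q j)/2 * ((q i + q j)/2) - q i * q j := by nlinarith [mul_pos (sub_pos.2 hlt) (sub_pos.2 hlt)]
      nlinarith
    have c3 : c = 0 := le_antisymm c1 c2
    rw [c3, zero_mul, add_zero] at hcv
    have m3 := hmin1 (⟨hv, hcv.trans hqF⟩ : _ ∈ K ∩ {q | FF S q = FF S q0})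
    simp only [Set.mem_ofPred_eq] at m3
    rw [sum_pair (fun t => t^2) q i j hij] at m3
    nlinarith [mul_pos (sub_pos.2 hlt) (sub_pos.2 hlt)]
  by_cases hex : ∃ i, 0 < q i ∧ q i < 1
  · obtain ⟨i, hi0, hi1⟩ := hex
    apply three_half q hqs (q i) hi0 hi1
    intro k
    by_cases k0 : q k = 0
    · exact Or.inl k0
    by_cases k1 : q k = 1
    · exact Or.inr (Or.inl k1)
    have k0' : 0 < q k := lt_of_le_of_ne (hbd k).1 (Ne.symm k0)
    have k1' : q k < 1 := lt_of_le_of_ne (hbd k).2 k1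
    exact Or.inr (Or.inr (le_antisymm (not_lt.1 (key i k hi0 k1')) (not_lt.1 (key k i k0' hi1))))
  · push Not at hex
    apply three_half q hqs (1/2) (by norm_num) (by norm_num)
    intro k
    rcases (hbd k).1.eq_or_lt with h | h
    · exact Or.inl h.symm
    · exact Or.inr (Or.inl (le_antisymm (hbd k).2 (hex k h)))

theorem rejective_le_two_poisson_of_upward_closed {N S : ℕ} (p : Fin N → ℝ)
    (hp : ∀ i, p i ∈ Set.Ioo (0 : ℝ) 1) (hsum : ∑ i, p i = S)
    (A : Finset (Finset (Fin N)))
    (hA : ∀ I ∈ A, ∀ J : Finset (Fin N), I ⊆ J → J ∈ A) :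
    (∑ I ∈ A.filter (fun I => I.card = S), PB p I) /
      (∑ I ∈ univ.filter (fun I => I.card = S), PB p I) ≤
    2 * ∑ I ∈ A, PB p I := by
  have hSN : S ≤ N := by
    have h : ∑ i, p i ≤ ∑ _i : Fin N, (1:ℝ) := Finset.sum_le_sum fun i _ => (hp i).2.le
    rw [hsum] at h
    simp at h
    exact h
  exact final_of_half p hp hSN A hA (half_main p hp hsum)
end

section
/- For rejective sampling with weights p_i ∈ (0,1), the ℓ-th order inclusion probabilities are monotone in the size parameter: π_L(S−1) ≤ π_L(S) for every subset L ⊆ [N] with |L| = ℓ and every S ≥ 1 (with 2 ≤ S ≤ N). -/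
open Finset

noncomputable def es {N : ℕ} (w : Fin N → ℝ) (M : Finset (Fin N)) (k : ℕ) : ℝ :=
  ∑ t ∈ powersetCard k M, ∏ i ∈ t, w i

lemma es_zero {N : ℕ} (w : Fin N → ℝ) (M : Finset (Fin N)) : es w M 0 = 1 := by
  simp [es]

lemma es_nonneg {N : ℕ} (w : Fin N → ℝ) (hw : ∀ i, 0 < w i) (M : Finset (Fin N)) (k : ℕ) :
    0 ≤ es w M k :=
  Finset.sum_nonneg fun _ _ => Finset.prod_nonneg fun i _ => (hw i).le

lemma es_insert {N : ℕ} (w : Fin N → ℝ) (M : Finset (Fin N)) (x : Fin N) (hx : x ∉ M) (k : ℕ) :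
    es w (insert x M) (k + 1) = es w M (k + 1) + w x * es w M k := by
  unfold es
  rw [powersetCard_succ_insert hx, sum_union, sum_image, mul_sum]
  · congr 1
    refine sum_congr rfl fun t ht => ?_
    rw [prod_insert]
    exact fun h => hx ((mem_powersetCard.1 ht).1 h)
  · intro s hs t ht h
    have h1 : x ∉ s := fun h => hx ((mem_powersetCard.1 hs).1 h)
    have h2 : x ∉ t := fun h => hx ((mem_powersetCard.1 ht).1 h)
    rw [← erase_insert h1, ← erase_insert h2]
    exact congrArg (fun u => u.erase x) h
  · rw [disjoint_left]
    intro t ht h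
    obtain ⟨s, _, rfl⟩ := mem_image.1 h
    exact hx ((mem_powersetCard.1 ht).1 (mem_insert_self x s))

lemma es_logconc {N : ℕ} (w : Fin N → ℝ) (hw : ∀ i, 0 < w i) (M : Finset (Fin N)) :
    ∀ a b : ℕ, a ≤ b → es w M a * es w M (b + 1) ≤ es w M (a + 1) * es w M b := by
  induction M using Finset.induction_on with
  | empty =>
    intro a b _
    have h : es w ∅ (b + 1) = 0 := by
      unfold es
      rw [powersetCard_eq_empty.2 (by simp)]; simp
    rw [h, mul_zero]
    exact mul_nonneg (es_nonneg w hw _ _) (es_nonneg w hw _ _)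
  | insert x M hx ih =>
    intro a b hab
    have hn := es_nonneg w hw M
    have hx0 := (hw x).le
    rcases Nat.eq_or_lt_of_le hab with rfl | hlt
    · rcases a with _ | a
      · simp only [es_insert w M x hx, es_zero]
        have := ih 0 0 le_rfl
        simp only [es_zero] at this
        linarith
      · simp only [es_insert w M x hx]
        have h1 := ih (a+1) (a+1) le_rfl
        have h2 := mul_le_mul_of_nonneg_left (ih a a le_rfl) (mul_nonneg hx0 hx0)
        have h3 := mul_le_mul_of_nonneg_left (ih a (a+1) (by omega)) hx0
        nlinarith
    · obtain ⟨b, rfl⟩ : ∃ c, b = c + 1 := ⟨b - 1, by omega⟩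
      rcases a with _ | a
      · simp only [es_insert w M x hx, es_zero]
        have h1 := ih 0 (b+1) (by omega)
        have h2 := mul_le_mul_of_nonneg_left (ih 0 b (by omega)) hx0
        have h3 := mul_nonneg (mul_nonneg hx0 hx0) (hn b)
        have h4 := mul_nonneg hx0 (mul_nonneg (hn (0+1)) (hn b))
        simp only [es_zero] at h1 h2
        nlinarith
      · simp only [es_insert w M x hx]
        have h1 := ih (a+1) (b+1) (by omega)
        have h2 := mul_le_mul_of_nonneg_left (ih a b (by omega)) (mul_nonneg hx0 hx0)
        have h3 := mul_le_mul_of_nonneg_left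
          ((ih a (b+1) (by omega)).trans (ih (a+1) b (by omega))) hx0
        nlinarith

lemma es_cross {N : ℕ} (w : Fin N → ℝ) (hw : ∀ i, 0 < w i) (M L : Finset (Fin N)) :
    Disjoint L M → ∀ a b : ℕ, a + L.card ≤ b →
      es w M a * es w (L ∪ M) (b + 1) ≤ es w M (a + 1) * es w (L ∪ M) b := by
  induction L using Finset.induction_on with
  | empty =>
    intro _ a b h
    rw [empty_union]
    exact es_logconc w hw M a b (by simpa using h)
  | insert x L hx ih =>
    intro hd a b h
    rw [card_insert_of_notMem hx] at h
    rw [disjoint_insert_left] at hd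
    obtain ⟨b, rfl⟩ : ∃ c, b = c + 1 := ⟨b - 1, by omega⟩
    have hx' : x ∉ L ∪ M := by simp [hx, hd.1]
    rw [insert_union, es_insert w _ x hx', es_insert w _ x hx']
    have h1 := ih hd.2 a (b+1) (by omega)
    have h2 := mul_le_mul_of_nonneg_left (ih hd.2 a b (by omega)) (hw x).le
    nlinarith

lemma PB_eq {N : ℕ} (p : Fin N → ℝ) (hp : ∀ i, p i ∈ Set.Ioo (0 : ℝ) 1) (I : Finset (Fin N)) :
    PB p I = (∏ j, (1 - p j)) * ∏ i ∈ I, (p i / (1 - p i)) := by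
  unfold PB
  rw [← prod_mul_prod_compl I (fun j => 1 - p j), prod_div_distrib]
  have : ∏ i ∈ I, (1 - p i) ≠ 0 := prod_ne_zero_iff.2 fun i _ => by linarith [(hp i).2]
  field_simp

lemma sum_all {N : ℕ} (p : Fin N → ℝ) (hp : ∀ i, p i ∈ Set.Ioo (0 : ℝ) 1) (S : ℕ) :
    ∑ I ∈ univ.filter (fun I : Finset (Fin N) => I.card = S), PB p I
      = (∏ j, (1 - p j)) * es (fun i => p i / (1 - p i)) univ S := by
  unfold es
  rw [mul_sum]
  refine sum_congr (by ext; simp [mem_powersetCard]) fun I _ => PB_eq p hp I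

lemma sum_L {N : ℕ} (p : Fin N → ℝ) (hp : ∀ i, p i ∈ Set.Ioo (0 : ℝ) 1)
    (L : Finset (Fin N)) (k : ℕ) :
    ∑ I ∈ univ.filter (fun I : Finset (Fin N) => I.card = k + L.card ∧ L ⊆ I), PB p I
      = (∏ j, (1 - p j)) * ((∏ i ∈ L, (p i / (1 - p i))) *
        es (fun i => p i / (1 - p i)) Lᶜ k) := by
  unfold es
  rw [mul_sum, mul_sum]
  refine sum_bij' (fun I _ => I \ L) (fun t _ => L ∪ t) ?_ ?_ ?_ ?_ ?_
  · intro I hI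
    simp only [mem_filter, mem_univ, true_and] at hI
    rw [mem_powersetCard, card_sdiff_of_subset hI.2]
    refine ⟨fun i hi => by simp at hi ⊢; exact hi.2, by omega⟩
  · intro t ht
    rw [mem_powersetCard] at ht
    have : Disjoint L t := (disjoint_left.2 fun i hi hL => by simpa [hL] using ht.1 hi).symm
    simp only [mem_filter, mem_univ, true_and]
    exact ⟨by rw [card_union_of_disjoint this]; omega, subset_union_left⟩
  · intro I hI
    simp only [mem_filter, mem_univ, true_and] at hI
    exact union_sdiff_of_subset hI.2
  · intro t ht
    rw [mem_powersetCard] at ht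
    have : Disjoint L t := (disjoint_left.2 fun i hi hL => by simpa [hL] using ht.1 hi).symm
    exact union_sdiff_cancel_left this
  · intro I hI
    simp only [mem_filter, mem_univ, true_and] at hI
    rw [PB_eq p hp, mul_comm (∏ i ∈ L, _), prod_sdiff hI.2]

theorem inclusion_prob_monotone_in_size {N S : ℕ} (p : Fin N → ℝ)
    (hp : ∀ i, p i ∈ Set.Ioo (0 : ℝ) 1) (hS : 2 ≤ S) (hSN : S ≤ N)
    (L : Finset (Fin N)) :
    incl p (S - 1) L ≤ incl p S L := by
  have hw : ∀ i, 0 < p i / (1 - p i) := fun i =>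
    div_pos (hp i).1 (by linarith [(hp i).2])
  have hC : 0 < ∏ j, (1 - p j) := prod_pos fun i _ => by linarith [(hp i).2]
  have hE : ∀ k ≤ N, 0 < es (fun i => p i / (1 - p i)) univ k := fun k hk =>
    sum_pos (fun t _ => prod_pos fun i _ => hw i)
      (powersetCard_nonempty.2 (by simpa using hk))
  have hPB : ∀ I, 0 ≤ PB p I := fun I => by
    rw [PB_eq p hp]
    exact mul_nonneg hC.le (prod_nonneg fun i _ => (hw i).le)
  by_cases h : S - 1 < L.card
  · have h0 : incl p (S - 1) L = 0 := by
      unfold incl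
      rw [filter_eq_empty_iff.2, sum_empty, zero_div]
      rintro I - ⟨h1, h2⟩
      have := card_le_card h2
      omega
    rw [h0]
    exact div_nonneg (sum_nonneg fun I _ => hPB I) (sum_nonneg fun I _ => hPB I)
  · obtain ⟨k, hk⟩ : ∃ k, S = k + 1 + L.card := ⟨S - 1 - L.card, by omega⟩
    have hk' : S - 1 = k + L.card := by omega
    have key := es_cross _ hw Lᶜ L disjoint_compl_right k (k + L.card) le_rfl
    rw [union_compl] at key
    have e1 := hE (k + L.card) (by omega)
    have e2 := hE (k + L.card + 1) (by omega)
    unfold incl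
    rw [hk', hk, sum_all p hp, sum_all p hp, sum_L p hp, sum_L p hp,
      mul_div_mul_left _ _ hC.ne', mul_div_mul_left _ _ hC.ne',
      show k + 1 + L.card = k + L.card + 1 by ring, div_le_div_iff₀ e1 e2,
      mul_assoc, mul_assoc]
    exact mul_le_mul_of_nonneg_left key (prod_nonneg fun i _ => (hw i).le)
end
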